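/- arXiv:2205.12112 — 3 statements merged into one kernel-verified Lean document; each statement's English description precedes it below -/
import Mathlib

section
/- Let π_ν be the multivariate student's t density on ℝ^d with ν > 0 degrees of freedom and take R = √d. For x ∈ ℝ^d write z_{d+1}(x) = (‖x‖² − d)/(‖x‖² + d) for the latitude of SP⁻¹(x). Then for all x, x̂ ∈ ℝ^d: log(π_ν(x̂)/π_ν(x)) + d · log((d + ‖x̂‖²)/(d + ‖x‖²)) = d · (g_{ν/d}(z_{d+1}(x)) − g_{ν/d}(z_{d+1}(x̂))). -/
/-- Multivariate student's t density with `ν` degrees of freedom on `ℝ^d`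
(with normalizing constant `c`): `π_ν(x) = c (1 + ‖x‖²/ν)^{−(ν+d)/2}`. -/
noncomputable def tDensity (d : ℕ) (ν c : ℝ) (x : EuclideanSpace ℝ (Fin d)) : ℝ :=
  c * (1 + ‖x‖ ^ 2 / ν) ^ (-(ν + d) / 2 : ℝ)

/-- `g_k(z) = ((k+1)/2) log(k + (1+z)/(1−z)) + log(1−z)`. -/
noncomputable def gfun (k z : ℝ) : ℝ :=
  ((k + 1) / 2) * Real.log (k + (1 + z) / (1 - z)) + Real.log (1 - z)

/-- `g_k` at the latitude `(s - d)/(s + d)` of a point of squared norm `s`. -/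
theorem gfun_latitude {d ν s : ℝ} (hd : 0 < d) (hν : 0 < ν) (hs : 0 ≤ s) :
    gfun (ν / d) ((s - d) / (s + d)) =
      ((ν / d + 1) / 2) * (Real.log (ν + s) - Real.log d) +
        (Real.log (2 * d) - Real.log (d + s)) := by
  have hsd : s + d ≠ 0 := by positivity
  have h_one_sub : 1 - (s - d) / (s + d) = 2 * d / (d + s) := by
    rw [add_comm d s]
    field_simp
    ring
  have h_one_add : 1 + (s - d) / (s + d) = 2 * s / (d + s) := by
    rw [add_comm d s]
    field_simp
    ring
  have h_arg : ν / d + 2 * s / (d + s) / (2 * d / (d + s)) = (ν + s) / d := by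
    have hds : d + s ≠ 0 := by positivity
    field_simp
  rw [gfun, h_one_sub, h_one_add, h_arg, Real.log_div (by positivity) hd.ne',
    Real.log_div (by positivity) (by positivity)]

theorem tDensity_pos (d : ℕ) {ν c : ℝ} (hν : 0 < ν) (hc : 0 < c)
    (x : EuclideanSpace ℝ (Fin d)) : 0 < tDensity d ν c x := by
  unfold tDensity
  positivity

theorem log_tDensity (d : ℕ) {ν c : ℝ} (hν : 0 < ν) (hc : 0 < c)
    (x : EuclideanSpace ℝ (Fin d)) :
    Real.log (tDensity d ν c x) =
      Real.log c + -(ν + d) / 2 * (Real.log (ν + ‖x‖ ^ 2) - Real.log ν) := by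
  have h_base : 1 + ‖x‖ ^ 2 / ν = (ν + ‖x‖ ^ 2) / ν := by
    field_simp
  rw [tDensity, Real.log_mul hc.ne' (by positivity), Real.log_rpow (by positivity), h_base,
    Real.log_div (by positivity) hν.ne']

/-- With `R = √d` and latitude `z_{d+1}(x) = (‖x‖² − d)/(‖x‖² + d)`, the SPS
log-acceptance ratio for the multivariate student's t target with `ν` degrees of
freedom equals `d (g_{ν/d}(z_{d+1}(x)) − g_{ν/d}(z_{d+1}(x̂)))`. -/
theorem stmt_6 (d : ℕ) (hd : 1 ≤ d) (ν c : ℝ) (hν : 0 < ν) (hc : 0 < c)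
    (x xhat : EuclideanSpace ℝ (Fin d)) :
    Real.log (tDensity d ν c xhat / tDensity d ν c x) +
        d * Real.log ((d + ‖xhat‖ ^ 2) / (d + ‖x‖ ^ 2)) =
      d * (gfun (ν / d) ((‖x‖ ^ 2 - d) / (‖x‖ ^ 2 + d)) -
            gfun (ν / d) ((‖xhat‖ ^ 2 - d) / (‖xhat‖ ^ 2 + d))) := by
  have hd' : (0 : ℝ) < d := by exact_mod_cast hd
  rw [Real.log_div (tDensity_pos d hν hc xhat).ne' (tDensity_pos d hν hc x).ne',
    log_tDensity d hν hc, log_tDensity d hν hc,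
    Real.log_div (by positivity) (by positivity),
    gfun_latitude hd' hν (sq_nonneg _), gfun_latitude hd' hν (sq_nonneg _)]
  field_simp
  ring
end

section
/- Let μ ∈ ℝ and σ > 0, and let W be a real random variable with Gaussian law N(μ, σ²). Then E[min(1, e^W)] = Φ(μ/σ) + exp(μ + σ²/2) · Φ(−σ − μ/σ), where Φ is the cumulative distribution function of the standard Gaussian N(0,1). -/
open MeasureTheory ProbabilityTheory

/-- The standard Gaussian cumulative distribution function
`Φ(t) = ∫_{−∞}^t (2π)^{−1/2} e^{−u²/2} du`. -/
noncomputable def stdPhi (t : ℝ) : ℝ :=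
  ∫ u in Set.Iic t, (Real.sqrt (2 * Real.pi))⁻¹ * Real.exp (-u ^ 2 / 2)

lemma gaussianPDFReal_zero_one (u : ℝ) :
    gaussianPDFReal 0 1 u = (Real.sqrt (2 * Real.pi))⁻¹ * Real.exp (-u ^ 2 / 2) := by
  simp [gaussianPDFReal]

lemma stdPhi_eq_setIntegral_gaussianPDFReal (t : ℝ) :
    stdPhi t = ∫ u in Set.Iic t, gaussianPDFReal 0 1 u := by
  simp only [stdPhi, gaussianPDFReal_zero_one]

lemma setIntegral_Ioi_gaussianPDFReal_add (t s : ℝ) :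
    ∫ u in Set.Ioi t, gaussianPDFReal 0 1 (u + s) = stdPhi (-s - t) := by
  have h := integral_comp_neg_Iic (-t) fun u ↦ gaussianPDFReal 0 1 (u + s)
  rw [neg_neg] at h
  rw [← h, stdPhi_eq_setIntegral_gaussianPDFReal, ← integral_indicator measurableSet_Iic,
    ← integral_indicator measurableSet_Iic,
    ← integral_add_right_eq_self _ s]
  refine integral_congr_ae (.of_forall fun u ↦ ?_)
  have h_mem : u + s ≤ -t ↔ u ≤ -s - t := by constructor <;> intro <;> linarith
  have h_pdf : gaussianPDFReal 0 1 (-(u + s) + s) = gaussianPDFReal 0 1 u := by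
    simp only [gaussianPDFReal_zero_one]
    ring_nf
  simp only [Set.indicator, Set.mem_Iic, h_mem, h_pdf]

lemma gaussianReal_map_sub_mul (μ σ : ℝ) :
    (gaussianReal 0 1).map (fun u ↦ μ - σ * u) = gaussianReal μ (Real.toNNReal (σ ^ 2)) := by
  have h : (fun u : ℝ ↦ μ - σ * u) = (μ - ·) ∘ (σ * ·) := rfl
  rw [h, ← Measure.map_map (by fun_prop) (by fun_prop), gaussianReal_map_const_mul,
    gaussianReal_map_const_sub]
  congr 1
  · simp
  · ext
    simp [sq_nonneg]

lemma gaussianPDFReal_mul_exp_sub (μ σ u : ℝ) :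
    gaussianPDFReal 0 1 u * Real.exp (μ - σ * u) =
      Real.exp (μ + σ ^ 2 / 2) * gaussianPDFReal 0 1 (u + σ) := by
  rw [gaussianPDFReal_zero_one, gaussianPDFReal_zero_one, mul_assoc, ← Real.exp_add,
    mul_left_comm, ← Real.exp_add]
  ring_nf

/-- If `W ~ N(μ, σ²)` with `σ > 0`, then the expected Metropolis–Hastings
acceptance probability satisfies
`E[min(1, e^W)] = Φ(μ/σ) + exp(μ + σ²/2) Φ(−σ − μ/σ)`. -/
theorem stmt_11 (μ σ : ℝ) (hσ : 0 < σ) :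
    ∫ w, min 1 (Real.exp w) ∂(gaussianReal μ (Real.toNNReal (σ ^ 2))) =
      stdPhi (μ / σ) + Real.exp (μ + σ ^ 2 / 2) * stdPhi (-σ - μ / σ) := by
  have h_int : Integrable fun u ↦ gaussianPDFReal 0 1 u * min 1 (Real.exp (μ - σ * u)) := by
    refine (integrable_gaussianPDFReal 0 1).mul_bdd (c := 1) (by fun_prop) (.of_forall fun u ↦ ?_)
    rw [Real.norm_of_nonneg (by positivity)]
    exact min_le_left _ _
  rw [← gaussianReal_map_sub_mul, integral_map (by fun_prop) (by fun_prop),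
    integral_gaussianReal_eq_integral_smul one_ne_zero]
  simp only [smul_eq_mul]
  rw [← intervalIntegral.integral_Iic_add_Ioi (b := μ / σ) h_int.integrableOn h_int.integrableOn,
    stdPhi_eq_setIntegral_gaussianPDFReal (μ / σ), ← setIntegral_Ioi_gaussianPDFReal_add,
    ← integral_const_mul]
  congr 1
  · refine setIntegral_congr_fun measurableSet_Iic fun u hu ↦ ?_
    have h : u * σ ≤ μ := (le_div_iff₀ hσ).1 hu
    rw [min_eq_left (Real.one_le_exp (by linarith)), mul_one]
  · refine setIntegral_congr_fun measurableSet_Ioi fun u hu ↦ ?_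
    have h : μ < u * σ := (div_lt_iff₀ hσ).1 hu
    rw [min_eq_right (Real.exp_le_one_iff.2 (by linarith)), gaussianPDFReal_mul_exp_sub]
end

section
/- Fix α > 0 and 0 < ε < 1, and let T̃ be a real random variable with probability density f(t) = (α/(ε(1 − ε^α))) · (t/ε + 1)^{−1−α} on [0, 1−ε] (and 0 elsewhere). Then E[T̃] = (ε/(1−ε)) log(1/ε) − ε if α = 1 and E[T̃] = (α/(1−α)) (ε^α − ε)/(1 − ε^α) − ε if α ≠ 1. Consequently, as ε → 0: ε^{−α} E[T̃] → α/(1−α) if α < 1, and ε^{−α} E[T̃] → +∞ if α ≥ 1. -/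
open MeasureTheory Filter

/-- The law of the conditional bounce time `T̃`: the probability measure on `ℝ`
with density `f(t) = (α/(ε(1 − ε^α))) (t/ε + 1)^{−1−α}` on `[0, 1−ε]`
(and `0` elsewhere) with respect to Lebesgue measure. -/
noncomputable def bounceLaw (α ε : ℝ) : Measure ℝ :=
  volume.withDensity fun t =>
    ENNReal.ofReal (Set.indicator (Set.Icc 0 (1 - ε))
      (fun t => α / (ε * (1 - ε ^ α)) * (t / ε + 1) ^ (-1 - α)) t)

/-- The mean `E[T̃]` of the conditional bounce time. -/
noncomputable def bounceMean (α ε : ℝ) : ℝ := ∫ t, t ∂(bounceLaw α ε)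

open Set in
/-- The mean bounce time as an integral of powers, after the substitution `u = t + ε`. -/
lemma bounceMean_eq_integral {α ε : ℝ} (hα : 0 < α) (h0 : 0 < ε) (h1 : ε < 1) :
    bounceMean α ε =
      α * ε ^ α / (1 - ε ^ α) * ∫ u in ε..1, (u ^ (-α) - ε * u ^ (-1 - α)) := by
  have hε : 0 < 1 - ε ^ α := sub_pos.2 (Real.rpow_lt_one h0.le h1 hα)
  have hmeas : Measurable fun t : ℝ => (Icc 0 (1 - ε)).indicator
      (fun t => α / (ε * (1 - ε ^ α)) * (t / ε + 1) ^ (-1 - α)) t :=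
    Measurable.indicator (by fun_prop) measurableSet_Icc
  have hnonneg (t : ℝ) : 0 ≤ (Icc 0 (1 - ε)).indicator
      (fun t => α / (ε * (1 - ε ^ α)) * (t / ε + 1) ^ (-1 - α)) t := by
    refine indicator_nonneg (fun t ht => ?_) t
    have := ht.1
    positivity
  unfold bounceMean bounceLaw
  rw [integral_withDensity_eq_integral_toReal_smul hmeas.ennreal_ofReal
    (ae_of_all _ fun _ => ENNReal.ofReal_lt_top)]
  simp_rw [ENNReal.toReal_ofReal (hnonneg _), smul_eq_mul]
  have hmul (t : ℝ) := (indicator_mul_left (Icc 0 (1 - ε))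
    (fun t => α / (ε * (1 - ε ^ α)) * (t / ε + 1) ^ (-1 - α)) (fun t => t) (i := t)).symm
  simp_rw [hmul]
  rw [integral_indicator measurableSet_Icc, integral_Icc_eq_integral_Ioc,
    ← intervalIntegral.integral_of_le (by linarith), ← intervalIntegral.integral_const_mul]
  have hshift := intervalIntegral.integral_comp_add_right (a := 0) (b := 1 - ε)
    (fun u => α * ε ^ α / (1 - ε ^ α) * (u ^ (-α) - ε * u ^ (-1 - α))) ε
  rw [zero_add, sub_add_cancel] at hshift
  rw [← hshift]
  refine intervalIntegral.integral_congr fun t ht => ?_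
  rw [uIcc_of_le (by linarith)] at ht
  have hu : 0 < t + ε := by linarith [ht.1]
  have hdiv : t / ε + 1 = (t + ε) / ε := by field_simp
  have hpow : (t + ε) ^ (-α) = (t + ε) * (t + ε) ^ (-1 - α) := by
    rw [← Real.rpow_one_add' hu.le (by linarith)]
    ring_nf
  have hεpow : ε ^ (-1 - α) = (ε * ε ^ α)⁻¹ := by
    rw [← Real.rpow_one_add' h0.le (by linarith), ← Real.rpow_neg h0.le]
    ring_nf
  have := Real.rpow_pos_of_pos h0 α
  rw [hdiv, Real.div_rpow hu.le h0.le, hpow, hεpow]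
  field_simp
  ring

open Set in
/-- Splitting off the second power reduces the mean bounce time to a single integral. -/
lemma bounceMean_eq_sub {α ε : ℝ} (hα : 0 < α) (h0 : 0 < ε) (h1 : ε < 1) :
    bounceMean α ε = α * ε ^ α / (1 - ε ^ α) * (∫ u in ε..1, u ^ (-α)) - ε := by
  have hε : 0 < 1 - ε ^ α := sub_pos.2 (Real.rpow_lt_one h0.le h1 hα)
  have hmem : (0 : ℝ) ∉ uIcc ε 1 := by
    rw [uIcc_of_le h1.le]
    exact fun h => h0.not_ge h.1
  have hpos := Real.rpow_pos_of_pos h0 α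
  have hexp : -1 - α + 1 = -α := by ring
  rw [bounceMean_eq_integral hα h0 h1, intervalIntegral.integral_sub
    (intervalIntegral.intervalIntegrable_rpow (Or.inr hmem))
    ((intervalIntegral.intervalIntegrable_rpow (Or.inr hmem)).const_mul ε),
    intervalIntegral.integral_const_mul,
    integral_rpow (r := -1 - α) (Or.inr ⟨by linarith, hmem⟩), hexp, Real.one_rpow,
    Real.rpow_neg h0.le]
  field_simp
  ring

lemma bounceMean_one {ε : ℝ} (h0 : 0 < ε) (h1 : ε < 1) :
    bounceMean 1 ε = ε / (1 - ε) * Real.log (1 / ε) - ε := by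
  rw [bounceMean_eq_sub one_pos h0 h1]
  simp_rw [Real.rpow_neg_one]
  rw [integral_inv_of_pos h0 one_pos, Real.rpow_one, one_mul]

open Set in
lemma bounceMean_of_ne_one {α ε : ℝ} (hα : 0 < α) (hne : α ≠ 1) (h0 : 0 < ε) (h1 : ε < 1) :
    bounceMean α ε = α / (1 - α) * ((ε ^ α - ε) / (1 - ε ^ α)) - ε := by
  have hε : 1 - ε ^ α ≠ 0 := (sub_pos.2 (Real.rpow_lt_one h0.le h1 hα)).ne'
  have hmem : (0 : ℝ) ∉ uIcc ε 1 := by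
    rw [uIcc_of_le h1.le]
    exact fun h => h0.not_ge h.1
  have hpos := Real.rpow_pos_of_pos h0 α
  have hα1 : 1 - α ≠ 0 := sub_ne_zero.2 hne.symm
  have hexp : -α + 1 = 1 - α := by ring
  rw [bounceMean_eq_sub hα h0 h1,
    integral_rpow (Or.inr ⟨fun h => hne (neg_injective h), hmem⟩), hexp, Real.one_rpow,
    Real.rpow_sub h0, Real.rpow_one]
  field_simp

lemma tendsto_rpow_nhdsWithin_Ioo_zero {a : ℝ} (ha : 0 < a) :
    Tendsto (fun x : ℝ => x ^ a) (nhdsWithin 0 (Set.Ioo 0 1)) (nhds 0) := by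
  simpa [Real.zero_rpow ha.ne'] using
    ((Real.continuousAt_rpow_const 0 a (Or.inr ha.le)).tendsto.mono_left nhdsWithin_le_nhds)

lemma tendsto_scaled_bounceMean_of_lt_one {α : ℝ} (hα : 0 < α) (hlt : α < 1) :
    Tendsto (fun ε : ℝ => ε ^ (-α) * bounceMean α ε)
      (nhdsWithin 0 (Set.Ioo 0 1)) (nhds (α / (1 - α))) := by
  have hp := tendsto_rpow_nhdsWithin_Ioo_zero (sub_pos.2 hlt)
  have hlim : Tendsto (fun ε : ℝ => α / (1 - α) * ((1 - ε ^ (1 - α)) / (1 - ε ^ α)) - ε ^ (1 - α))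
      (nhdsWithin 0 (Set.Ioo 0 1)) (nhds (α / (1 - α))) := by
    simpa using (((hp.const_sub 1).div
      ((tendsto_rpow_nhdsWithin_Ioo_zero hα).const_sub 1) (by simp)).const_mul
        (α / (1 - α))).sub hp
  refine hlim.congr' (eventually_mem_nhdsWithin.mono fun ε hε => ?_)
  have hpos := Real.rpow_pos_of_pos hε.1 α
  beta_reduce
  rw [bounceMean_of_ne_one hα hlt.ne hε.1 hε.2, Real.rpow_neg hε.1.le, Real.rpow_sub hε.1,
    Real.rpow_one]
  have hd : 1 - ε ^ α ≠ 0 := (sub_pos.2 (Real.rpow_lt_one hε.1.le hε.2 hα)).ne'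
  field_simp

lemma tendsto_scaled_bounceMean_one :
    Tendsto (fun ε : ℝ => ε ^ (-1 : ℝ) * bounceMean 1 ε)
      (nhdsWithin 0 (Set.Ioo 0 1)) atTop := by
  have hlog : Tendsto (fun ε : ℝ => -Real.log ε) (nhdsWithin 0 (Set.Ioo 0 1)) atTop :=
    tendsto_neg_atBot_atTop.comp
      (Real.tendsto_log_nhdsGT_zero.mono_left (nhdsWithin_mono _ Set.Ioo_subset_Ioi_self))
  refine tendsto_atTop_mono' _ (eventually_mem_nhdsWithin.mono fun ε hε => ?_)
    (tendsto_atTop_add_const_right _ (-1) hlog)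
  have h0 := hε.1
  have hd : 0 < 1 - ε := sub_pos.2 hε.2
  have hl : 0 ≤ -Real.log ε := neg_nonneg.2 (Real.log_nonpos h0.le hε.2.le)
  beta_reduce
  rw [bounceMean_one h0 hε.2, Real.rpow_neg_one, one_div, Real.log_inv]
  have hrw : ε⁻¹ * (ε / (1 - ε) * -Real.log ε - ε) = -Real.log ε / (1 - ε) + -1 := by
    field_simp
    ring
  rw [hrw]
  gcongr
  exact le_div_self hl hd (by linarith)

lemma tendsto_scaled_bounceMean_of_one_lt {α : ℝ} (hlt : 1 < α) :
    Tendsto (fun ε : ℝ => ε ^ (-α) * bounceMean α ε)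
      (nhdsWithin 0 (Set.Ioo 0 1)) atTop := by
  have hα : 0 < α := one_pos.trans hlt
  have hα1 : 0 < α - 1 := sub_pos.2 hlt
  have hp := tendsto_rpow_nhdsWithin_Ioo_zero hα1
  have hlim : Tendsto (fun ε : ℝ => α / (α - 1) * ((1 - ε ^ (α - 1)) / (1 - ε ^ α)) - 1)
      (nhdsWithin 0 (Set.Ioo 0 1)) (nhds (α / (α - 1) - 1)) := by
    simpa using (((hp.const_sub 1).div
      ((tendsto_rpow_nhdsWithin_Ioo_zero hα).const_sub 1) (by simp)).const_mul
        (α / (α - 1))).sub_const 1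
  have hinv : Tendsto (fun ε : ℝ => (ε ^ (α - 1))⁻¹) (nhdsWithin 0 (Set.Ioo 0 1)) atTop :=
    tendsto_inv_nhdsGT_zero.comp (tendsto_nhdsWithin_iff.2
      ⟨hp, eventually_mem_nhdsWithin.mono fun ε hε => Real.rpow_pos_of_pos hε.1 _⟩)
  have hc : 0 < α / (α - 1) - 1 := sub_pos.2 ((one_lt_div hα1).2 (by linarith))
  refine (hinv.atTop_mul_pos hc hlim).congr' (eventually_mem_nhdsWithin.mono fun ε hε => ?_)
  have h0 := hε.1
  have hpos := Real.rpow_pos_of_pos h0 α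
  have hd : 1 - ε ^ α ≠ 0 := (sub_pos.2 (Real.rpow_lt_one h0.le hε.2 hα)).ne'
  have hflip : α / (1 - α) = -(α / (α - 1)) := by
    rw [← div_neg, neg_sub]
  beta_reduce
  rw [bounceMean_of_ne_one hα hlt.ne' h0 hε.2, Real.rpow_neg h0.le, Real.rpow_sub h0,
    Real.rpow_one, hflip]
  field_simp
  ring

/-- Expected conditional bounce time of the bouncy particle sampler for the
one-dimensional target `f_ε(t) ∝ (ε + |t|)^{−α}`:
`E[T̃] = (ε/(1−ε)) log(1/ε) − ε` if `α = 1`, and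
`E[T̃] = (α/(1−α))(ε^α − ε)/(1 − ε^α) − ε` if `α ≠ 1`; consequently, as
`ε → 0⁺`, `ε^{−α} E[T̃] → α/(1−α)` if `α < 1` and `ε^{−α} E[T̃] → +∞` if
`α ≥ 1`. -/
theorem stmt_14 (α : ℝ) (hα : 0 < α) :
    (∀ ε : ℝ, 0 < ε → ε < 1 →
      (α = 1 → bounceMean α ε = ε / (1 - ε) * Real.log (1 / ε) - ε) ∧
      (α ≠ 1 → bounceMean α ε = α / (1 - α) * ((ε ^ α - ε) / (1 - ε ^ α)) - ε)) ∧
    (α < 1 → Tendsto (fun ε : ℝ => ε ^ (-α) * bounceMean α ε)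
      (nhdsWithin 0 (Set.Ioo 0 1)) (nhds (α / (1 - α)))) ∧
    (1 ≤ α → Tendsto (fun ε : ℝ => ε ^ (-α) * bounceMean α ε)
      (nhdsWithin 0 (Set.Ioo 0 1)) atTop) := by
  refine ⟨fun ε h0 h1 => ⟨?_, fun hne => bounceMean_of_ne_one hα hne h0 h1⟩,
    tendsto_scaled_bounceMean_of_lt_one hα, fun hle => ?_⟩
  · rintro rfl
    exact bounceMean_one h0 h1
  · rcases hle.eq_or_lt with rfl | hlt
    · exact tendsto_scaled_bounceMean_one
    · exact tendsto_scaled_bounceMean_of_one_lt hlt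
end
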